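/- Let X₀ and X₁ be reflexive real Banach spaces and let I : X₀ × X₁ → ℝ be a perfect pairing. Let B₀ ⊂ X₀ and B₁ ⊂ X₁ be linear subspaces such that B₀ ⊂ A₀ := B₁^⊥ and B₁ ⊂ A₁ := B₀^⊥. Then the map A₁/cl B₁ → (A₀/cl B₀)* sending [y] to the functional [x] ↦ I(x,y) is a well-defined isomorphism of Banach spaces; that is, the induced pairing exhibits A₁/cl B₁ as the dual Banach space of A₀/cl B₀. -/

import Mathlib

open NormedSpace

/-- The annihilator of a set `S ⊆ X₁` in `X₀` with respect to a continuous
bilinear pairing `I : X₀ × X₁ → ℝ`. -/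
def leftAnnihilator {X₀ X₁ : Type*} [NormedAddCommGroup X₀] [NormedSpace ℝ X₀]
    [NormedAddCommGroup X₁] [NormedSpace ℝ X₁]
    (I : X₀ →L[ℝ] X₁ →L[ℝ] ℝ) (S : Set X₁) : Submodule ℝ X₀ where
  carrier := {x : X₀ | ∀ s ∈ S, I x s = 0}
  add_mem' := by
    intro a b ha hb s hs
    simp [ha s hs, hb s hs]
  zero_mem' := by
    intro s hs
    simp
  smul_mem' := by
    intro c a ha s hs
    simp [ha s hs]

/-- The map `F ⧸ Q → (E ⧸ P)*` induced by a continuous bilinear form `J` on `E × F` that vanishes on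
`P × F` and on `E × Q`. -/
noncomputable def quotientPairing {E F : Type*} [NormedAddCommGroup E] [NormedSpace ℝ E]
    [NormedAddCommGroup F] [NormedSpace ℝ F] (J : E →L[ℝ] F →L[ℝ] ℝ)
    (P : Submodule ℝ E) (Q : Submodule ℝ F)
    (hP : ∀ x ∈ P, ∀ y, J x y = 0) (hQ : ∀ y ∈ Q, ∀ x, J x y = 0) :
    (F ⧸ Q) →L[ℝ] ((E ⧸ P) →L[ℝ] ℝ) :=
  Q.liftQL (P.liftQL J fun x hx => ContinuousLinearMap.ext (hP x hx)).flip fun y hy => by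
    refine ContinuousLinearMap.ext fun q => ?_
    obtain ⟨x, rfl⟩ := Submodule.Quotient.mk_surjective P q
    exact hQ y hy x

theorem quotientPairing_mk_mk {E F : Type*} [NormedAddCommGroup E] [NormedSpace ℝ E]
    [NormedAddCommGroup F] [NormedSpace ℝ F] (J : E →L[ℝ] F →L[ℝ] ℝ)
    (P : Submodule ℝ E) (Q : Submodule ℝ F)
    (hP : ∀ x ∈ P, ∀ y, J x y = 0) (hQ : ∀ y ∈ Q, ∀ x, J x y = 0) (x : E) (y : F) :
    quotientPairing J P Q hP hQ (Submodule.Quotient.mk y) (Submodule.Quotient.mk x) = J x y :=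
  rfl

/-- A point outside the closure of a subspace is separated from it by a continuous functional. -/
theorem exists_dual_eq_zero_of_notMem_topologicalClosure {E : Type*} [NormedAddCommGroup E]
    [NormedSpace ℝ E] (B : Submodule ℝ E) {y : E} (hy : y ∉ B.topologicalClosure) :
    ∃ f : E →L[ℝ] ℝ, (∀ b ∈ B, f b = 0) ∧ f y ≠ 0 := by
  have : IsClosed (B.topologicalClosure : Set E) := B.isClosed_topologicalClosure
  have hne : (Submodule.Quotient.mk y : E ⧸ B.topologicalClosure) ≠ 0 := fun h =>
    hy ((Submodule.Quotient.mk_eq_zero _).1 h)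
  obtain ⟨g, hg⟩ := SeparatingDual.exists_ne_zero (R := ℝ) hne
  refine ⟨g.comp B.topologicalClosure.mkQL, fun b hb => ?_, hg⟩
  have hb0 : (Submodule.Quotient.mk b : E ⧸ B.topologicalClosure) = 0 :=
    (Submodule.Quotient.mk_eq_zero _).2 (B.le_topologicalClosure hb)
  exact (congrArg g hb0).trans (map_zero g)

/-- A subspace's relative closure is the trace of its closure. -/
theorem mem_topologicalClosure_comap_subtype {E : Type*} [NormedAddCommGroup E]
    [NormedSpace ℝ E] {A B : Submodule ℝ E} (hBA : B ≤ A) {y : A}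
    (hy : (y : E) ∈ B.topologicalClosure) :
    y ∈ (B.comap A.subtype).topologicalClosure := by
  change y ∈ closure ((↑) ⁻¹' (B : Set E) : Set A)
  have himage : ((↑) '' ((↑) ⁻¹' (B : Set E) : Set A) : Set E) = B :=
    (Subtype.image_preimage_coe (A : Set E) B).trans (Set.inter_eq_right.2 hBA)
  rw [closure_subtype, himage]
  exact hy

/-- A continuous functional vanishing on a subspace vanishes on its closure. -/
theorem eq_zero_of_mem_topologicalClosure {E : Type*} [NormedAddCommGroup E]
    [NormedSpace ℝ E] {B : Submodule ℝ E} (f : E →L[ℝ] ℝ) (hf : ∀ b ∈ B, f b = 0) {x : E}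
    (hx : x ∈ B.topologicalClosure) : f x = 0 :=
  B.topologicalClosure_minimal (t := f.ker) hf f.isClosed_ker hx

theorem isClosed_leftAnnihilator {X₀ X₁ : Type*} [NormedAddCommGroup X₀] [NormedSpace ℝ X₀]
    [NormedAddCommGroup X₁] [NormedSpace ℝ X₁] (I : X₀ →L[ℝ] X₁ →L[ℝ] ℝ) (S : Set X₁) :
    IsClosed (leftAnnihilator I S : Set X₀) := by
  have h : (leftAnnihilator I S : Set X₀) = ⋂ s ∈ S, {x | I.flip s x = 0} := by
    ext x
    simp [leftAnnihilator]
  rw [h]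
  exact isClosed_biInter fun s _ => isClosed_eq (I.flip s).continuous continuous_const

/-- The open mapping theorem for a bijective continuous linear map between Banach spaces. -/
theorem exists_continuousLinearEquiv_of_bijective {E F : Type*} [NormedAddCommGroup E]
    [NormedSpace ℝ E] [CompleteSpace E] [NormedAddCommGroup F] [NormedSpace ℝ F] [CompleteSpace F]
    (T : E →L[ℝ] F) (hT : Function.Bijective T) : ∃ e : E ≃L[ℝ] F, ∀ x, e x = T x :=
  ⟨ContinuousLinearEquiv.ofBijective T (LinearMap.ker_eq_bot.2 hT.1)
    (LinearMap.range_eq_top.2 hT.2), fun _ => rfl⟩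

/-- **Duality between quotients of annihilators.**
Let `X₀, X₁` be reflexive real Banach spaces and `I : X₀ × X₁ → ℝ` a perfect pairing
(the two induced continuous linear maps into the duals are isomorphisms of Banach
spaces; for continuous linear maps between Banach spaces this is equivalent to
bijectivity, by the open mapping theorem).  Let `B₀ ⊆ A₀ := B₁^⊥` and
`B₁ ⊆ A₁ := B₀^⊥` be linear subspaces.  Then the map
`A₁/cl B₁ → (A₀/cl B₀)*`, `[y] ↦ ([x] ↦ I(x,y))`, is a well-defined isomorphism of
Banach spaces: the induced pairing exhibits `A₁/cl B₁` as the dual of `A₀/cl B₀`. -/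
theorem quotient_is_dual_of_quotient
    {X₀ X₁ : Type*} [NormedAddCommGroup X₀] [NormedSpace ℝ X₀] [CompleteSpace X₀]
    [NormedAddCommGroup X₁] [NormedSpace ℝ X₁] [CompleteSpace X₁]
    (hrefl₀ : Function.Surjective (inclusionInDoubleDual ℝ X₀))
    (hrefl₁ : Function.Surjective (inclusionInDoubleDual ℝ X₁))
    (I : X₀ →L[ℝ] X₁ →L[ℝ] ℝ)
    (hI : Function.Bijective I) (hIflip : Function.Bijective I.flip)
    (B₀ : Submodule ℝ X₀) (B₁ : Submodule ℝ X₁)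
    (A₀ : Submodule ℝ X₀) (A₁ : Submodule ℝ X₁)
    (hA₀ : A₀ = leftAnnihilator I (B₁ : Set X₁))
    (hA₁ : A₁ = leftAnnihilator I.flip (B₀ : Set X₀))
    (hB₀ : B₀ ≤ A₀) (hB₁ : B₁ ≤ A₁) :
    ∃ e : (A₁ ⧸ (B₁.comap A₁.subtype).topologicalClosure) ≃L[ℝ]
        ((A₀ ⧸ (B₀.comap A₀.subtype).topologicalClosure) →L[ℝ] ℝ),
      ∀ (a₁ : A₁) (a₀ : A₀),
        e (Submodule.Quotient.mk a₁) (Submodule.Quotient.mk a₀) = I a₀ a₁ := by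
  have hmem₀ : ∀ x, x ∈ A₀ ↔ ∀ b ∈ B₁, I x b = 0 := fun x => by rw [hA₀]; rfl
  have hmem₁ : ∀ y, y ∈ A₁ ↔ ∀ b ∈ B₀, I b y = 0 := fun y => by rw [hA₁]; rfl
  have : CompleteSpace A₁ := by
    subst hA₁
    exact (isClosed_leftAnnihilator I.flip (B₀ : Set X₀)).completeSpace_coe
  have : IsClosed ((B₁.comap A₁.subtype).topologicalClosure : Set A₁) :=
    Submodule.isClosed_topologicalClosure _
  have : IsClosed ((B₀.comap A₀.subtype).topologicalClosure : Set A₀) :=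
    Submodule.isClosed_topologicalClosure _
  let J : A₀ →L[ℝ] A₁ →L[ℝ] ℝ := I.bilinearComp A₀.subtypeL A₁.subtypeL
  let T := quotientPairing J (B₀.comap A₀.subtype).topologicalClosure
    (B₁.comap A₁.subtype).topologicalClosure
    (fun x hx y => eq_zero_of_mem_topologicalClosure (J.flip y)
      (fun b hb => (hmem₁ y).1 y.2 b hb) hx)
    (fun y hy x => eq_zero_of_mem_topologicalClosure (J x)
      (fun b hb => (hmem₀ x).1 x.2 b hb) hy)
  have hT : ∀ (y : A₁) (x : A₀),
      T (Submodule.Quotient.mk y) (Submodule.Quotient.mk x) = I x y :=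
    fun y x => quotientPairing_mk_mk J _ _ _ _ x y
  have hinj : Function.Injective T := by
    refine (injective_iff_map_eq_zero T).2 fun q hq => ?_
    obtain ⟨y, rfl⟩ := Submodule.Quotient.mk_surjective _ q
    refine (Submodule.Quotient.mk_eq_zero _).2 (mem_topologicalClosure_comap_subtype hB₁ ?_)
    by_contra hy
    obtain ⟨f, hf, hfy⟩ := exists_dual_eq_zero_of_notMem_topologicalClosure B₁ hy
    obtain ⟨x, rfl⟩ := hI.2 f
    refine hfy ((hT y ⟨x, (hmem₀ x).2 hf⟩).symm.trans ?_)
    exact DFunLike.congr_fun hq _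
  have hsurj : Function.Surjective T := fun φ => by
    obtain ⟨g, hg, -⟩ := exists_extension_norm_eq A₀ (φ.comp (Submodule.mkQL _))
    obtain ⟨y, rfl⟩ := hIflip.2 g
    have hy : y ∈ A₁ := (hmem₁ y).2 fun b hb => by
      have hb0 : (Submodule.Quotient.mk ⟨b, hB₀ hb⟩ :
          A₀ ⧸ (B₀.comap A₀.subtype).topologicalClosure) = 0 :=
        (Submodule.Quotient.mk_eq_zero _).2 (Submodule.le_topologicalClosure _ hb)
      exact (hg ⟨b, hB₀ hb⟩).trans ((congrArg φ hb0).trans (map_zero φ))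
    refine ⟨Submodule.Quotient.mk ⟨y, hy⟩, ContinuousLinearMap.ext fun q => ?_⟩
    obtain ⟨x, rfl⟩ := Submodule.Quotient.mk_surjective _ q
    exact hg x
  clear_value T
  obtain ⟨e, he⟩ := exists_continuousLinearEquiv_of_bijective
    (E := A₁ ⧸ (B₁.comap A₁.subtype).topologicalClosure)
    (F := (A₀ ⧸ (B₀.comap A₀.subtype).topologicalClosure) →L[ℝ] ℝ) T ⟨hinj, hsurj⟩
  exact ⟨e, fun y x => (DFunLike.congr_fun (he _) _).trans (hT y x)⟩
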